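/- Let (C_*, ∂, ℓ) be a Floer-type complex over a field F (with trivial Γ), and fix real numbers a ≤ a' ≤ b ≤ b'. Writing H_k^{(s,t]} for the degree-k homology of the quotient complex C_*^t / C_*^s where C_*^t = {x : ℓ(x) ≤ t}, the sequence H_k^{(a,b]} → H_k^{(a,b']} ⊕ H_k^{(a',b]} → H_k^{(a',b']} is exact at the middle, where the first map is (ι, π) induced by inclusion and projection, and the second is π' − ι'. -/

import Mathlib

/-- A Floer-type complex over a field `K` (trivial `Γ`): a chain complex of
`K`-vector spaces equipped with a filtration function `ℓ : C_* → ℝ ∪ {−∞}`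
satisfying `ℓ(x) = −∞ ↔ x = 0`, `ℓ(x+y) ≤ max (ℓ x) (ℓ y)`, `ℓ(c•x) = ℓ(x)` for
`c ≠ 0`, and `ℓ(∂x) ≤ ℓ(x)`. -/
structure FloerComplex (K : Type) [Field K] where
  C : ℤ → Type
  acg : ∀ k, AddCommGroup (C k)
  mod : ∀ k, Module K (C k)
  d : ∀ k : ℤ, C (k + 1) →ₗ[K] C k
  dd : ∀ (k : ℤ) (x : C (k + 1 + 1)), d k (d (k + 1) x) = 0
  ell : ∀ {k : ℤ}, C k → WithBot ℝ
  ell_bot : ∀ {k : ℤ} (x : C k), ell x = ⊥ ↔ x = 0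
  ell_add : ∀ {k : ℤ} (x y : C k), ell (x + y) ≤ max (ell x) (ell y)
  ell_smul : ∀ {k : ℤ} (c : K), c ≠ 0 → ∀ x : C k, ell (c • x) = ell x
  ell_d : ∀ (k : ℤ) (x : C (k + 1)), ell (d k x) ≤ ell x

attribute [instance] FloerComplex.acg FloerComplex.mod

namespace FloerComplex

variable {K : Type} [Field K] (X : FloerComplex K)

/-- The sublevel subcomplex `C^t = {x : ℓ(x) ≤ t}` in degree `k`. -/
def lvl (t : ℝ) (k : ℤ) : Submodule K (X.C k) where
  carrier := {x | X.ell x ≤ (t : WithBot ℝ)}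
  add_mem' {x y} hx hy := le_trans (X.ell_add x y) (max_le hx hy)
  zero_mem' := by
    have h : X.ell (0 : X.C k) = ⊥ := (X.ell_bot (0 : X.C k)).mpr rfl
    show X.ell (0 : X.C k) ≤ (t : WithBot ℝ)
    rw [h]; exact bot_le
  smul_mem' := by
    intro c x hx
    by_cases hc : c = 0
    · subst hc
      show X.ell ((0 : K) • x) ≤ (t : WithBot ℝ)
      rw [zero_smul, (X.ell_bot _).mpr rfl]
      exact bot_le
    · show X.ell (c • x) ≤ (t : WithBot ℝ)
      rw [X.ell_smul c hc x]
      exact hx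

lemma lvl_mono {s t : ℝ} (h : s ≤ t) (k : ℤ) : X.lvl s k ≤ X.lvl t k := by
  intro x hx
  exact le_trans hx (WithBot.coe_le_coe.mpr h)

/-- The interlevel (window) complex `C^{(a,b]} = C^b / C^a` in degree `k`. -/
abbrev win (a b : ℝ) (k : ℤ) :=
  ↥(X.lvl b k) ⧸ Submodule.comap (X.lvl b k).subtype (X.lvl a k)

/-- The differential restricted to a sublevel subcomplex. -/
def dLvl (t : ℝ) (k : ℤ) : ↥(X.lvl t (k + 1)) →ₗ[K] ↥(X.lvl t k) :=
  (X.d k).restrict (fun x hx => le_trans (X.ell_d k x) hx)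

/-- The differential of the window complex `C^{(a,b]}`. -/
def dWin (a b : ℝ) (k : ℤ) : X.win a b (k + 1) →ₗ[K] X.win a b k :=
  Submodule.mapQ _ _ (X.dLvl b k)
    (by
      intro x hx
      show ((X.dLvl b k x : X.C k)) ∈ X.lvl a k
      show X.ell (X.d k (x : X.C (k+1))) ≤ _
      exact le_trans (X.ell_d k (x : X.C (k+1))) hx)

/-- The canonical chain map `C^{(a,b]} → C^{(a',b']}` for `a ≤ a'`, `b ≤ b'`,
induced by the inclusion `C^b ⊆ C^{b'}`. -/
def winMap {a a' b b' : ℝ} (ha : a ≤ a') (hb : b ≤ b') (k : ℤ) :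
    X.win a b k →ₗ[K] X.win a' b' k :=
  Submodule.mapQ _ _ (Submodule.inclusion (X.lvl_mono hb k))
    (by
      intro x hx
      show ((Submodule.inclusion (X.lvl_mono hb k) x : X.C k)) ∈ X.lvl a' k
      exact X.lvl_mono ha k hx)

/-- Cycles of the window complex (in chain degree `k+1`). -/
def cyc (a b : ℝ) (k : ℤ) : Submodule K (X.win a b (k + 1)) :=
  LinearMap.ker (X.dWin a b k)

/-- Boundaries of the window complex (in chain degree `k+1`). -/
def bdry (a b : ℝ) (k : ℤ) : Submodule K (X.win a b (k + 1)) :=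
  LinearMap.range (X.dWin a b (k + 1))

/-- The interlevel filtered homology `H^{(a,b]}` (of the chain degree `k+1` part of
the window complex; as `k` ranges over `ℤ` this is all of the homology). -/
abbrev Hwin (a b : ℝ) (k : ℤ) :=
  ↥(X.cyc a b k) ⧸ Submodule.comap (X.cyc a b k).subtype (X.bdry a b k)

lemma winMap_dWin {a a' b b' : ℝ} (ha : a ≤ a') (hb : b ≤ b') (k : ℤ)
    (x : X.win a b (k + 1)) :
    X.winMap ha hb k (X.dWin a b k x) = X.dWin a' b' k (X.winMap ha hb (k + 1) x) := by
  obtain ⟨y, rfl⟩ := Submodule.Quotient.mk_surjective _ x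
  simp only [dWin, winMap, Submodule.mapQ_apply]
  rfl

lemma winMap_cyc {a a' b b' : ℝ} (ha : a ≤ a') (hb : b ≤ b') (k : ℤ) :
    ∀ x ∈ X.cyc a b k, X.winMap ha hb (k + 1) x ∈ X.cyc a' b' k := by
  intro x hx
  have h := X.winMap_dWin ha hb k x
  have hx0 : X.dWin a b k x = 0 := hx
  rw [hx0, map_zero] at h
  exact (h.symm : _)

/-- The induced map `H^{(a,b]} → H^{(a',b']}` on interlevel homology. -/
def Hmap {a a' b b' : ℝ} (ha : a ≤ a') (hb : b ≤ b') (k : ℤ) :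
    X.Hwin a b k →ₗ[K] X.Hwin a' b' k :=
  Submodule.mapQ _ _
    ((X.winMap ha hb (k + 1)).restrict (X.winMap_cyc ha hb k))
    (by
      intro x hx
      show (((X.winMap ha hb (k+1)).restrict (X.winMap_cyc ha hb k) x : X.win a' b' (k+1)))
        ∈ X.bdry a' b' k
      obtain ⟨y, hy⟩ := hx
      refine ⟨X.winMap ha hb (k + 1 + 1) y, ?_⟩
      show X.dWin a' b' (k+1) (X.winMap ha hb (k+1+1) y) = X.winMap ha hb (k+1) (x : X.win a b (k+1))
      rw [← X.winMap_dWin ha hb (k+1) y]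
      exact congrArg _ hy)

end FloerComplex

namespace FloerComplex

variable {K : Type} [Field K] (X : FloerComplex K)

/-- The interlevel homology class of a chain `u ∈ C^b` with `∂u ∈ C^a`. -/
def homologyClass {a b : ℝ} {k : ℤ} (u : X.C (k + 1)) (hu : u ∈ X.lvl b (k + 1))
    (hdu : X.d k u ∈ X.lvl a k) : X.Hwin a b k :=
  Submodule.Quotient.mk ⟨Submodule.Quotient.mk ⟨u, hu⟩, by
    show X.dWin a b k (Submodule.Quotient.mk ⟨u, hu⟩) = 0
    rw [dWin, Submodule.mapQ_apply, Submodule.Quotient.mk_eq_zero]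
    exact hdu⟩

lemma exists_homologyClass_eq {a b : ℝ} {k : ℤ} (x : X.Hwin a b k) :
    ∃ (u : X.C (k + 1)) (hu : u ∈ X.lvl b (k + 1)) (hdu : X.d k u ∈ X.lvl a k),
      X.homologyClass u hu hdu = x := by
  obtain ⟨⟨y, hy⟩, rfl⟩ := Submodule.Quotient.mk_surjective _ x
  obtain ⟨⟨u, hu⟩, rfl⟩ := Submodule.Quotient.mk_surjective _ y
  refine ⟨u, hu, ?_, rfl⟩
  have h : X.dWin a b k (Submodule.Quotient.mk ⟨u, hu⟩) = 0 := hy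
  rw [dWin, Submodule.mapQ_apply, Submodule.Quotient.mk_eq_zero] at h
  exact h

lemma Hmap_homologyClass {a a' b b' : ℝ} (ha : a ≤ a') (hb : b ≤ b') {k : ℤ}
    (u : X.C (k + 1)) (hu : u ∈ X.lvl b (k + 1)) (hdu : X.d k u ∈ X.lvl a k) :
    X.Hmap ha hb k (X.homologyClass u hu hdu) =
      X.homologyClass u (X.lvl_mono hb _ hu) (X.lvl_mono ha _ hdu) := rfl

lemma homologyClass_eq_iff {a b : ℝ} {k : ℤ} {u v : X.C (k + 1)}
    (hu : u ∈ X.lvl b (k + 1)) (hdu : X.d k u ∈ X.lvl a k)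
    (hv : v ∈ X.lvl b (k + 1)) (hdv : X.d k v ∈ X.lvl a k) :
    X.homologyClass u hu hdu = X.homologyClass v hv hdv ↔
      ∃ z ∈ X.lvl b (k + 1 + 1), X.d (k + 1) z - (u - v) ∈ X.lvl a (k + 1) := by
  rw [homologyClass, homologyClass, Submodule.Quotient.eq]
  constructor
  · rintro ⟨y, hy⟩
    obtain ⟨⟨z, hz⟩, rfl⟩ := Submodule.Quotient.mk_surjective _ y
    let u' : X.lvl b (k + 1) := ⟨u, hu⟩
    let v' : X.lvl b (k + 1) := ⟨v, hv⟩
    exact ⟨z, hz, (Submodule.Quotient.eq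
      (Submodule.comap (X.lvl b (k + 1)).subtype (X.lvl a (k + 1)))
      (x := X.dLvl b (k + 1) ⟨z, hz⟩) (y := u' - v')).mp hy⟩
  · rintro ⟨z, hz, h⟩
    exact ⟨Submodule.Quotient.mk ⟨z, hz⟩, (Submodule.Quotient.eq _).mpr h⟩

end FloerComplex

open FloerComplex in
/-- For a Floer-type complex over a field `F` (trivial `Γ`) with finite-dimensional
chain groups, and `a ≤ a' ≤ b ≤ b'`, the sequence
`H^{(a,b]} → H^{(a,b']} ⊕ H^{(a',b]} → H^{(a',b']}` (first map `(ι,π)`, second map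
`π' − ι'`) is exact at the middle term, in every degree. -/
theorem interlevel_middle_exact {K : Type} [Field K] (X : FloerComplex K)
    (hfd : ∀ k : ℤ, FiniteDimensional K (X.C k))
    (a a' b b' : ℝ) (haa' : a ≤ a') (ha'b : a' ≤ b) (hbb' : b ≤ b') (k : ℤ) :
    (∀ w : X.Hwin a b k,
      X.Hmap haa' (le_refl b') k (X.Hmap (le_refl a) hbb' k w)
        = X.Hmap (le_refl a') hbb' k (X.Hmap haa' (le_refl b) k w)) ∧
    (∀ (x : X.Hwin a b' k) (y : X.Hwin a' b k),
      X.Hmap haa' (le_refl b') k x = X.Hmap (le_refl a') hbb' k y →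
      ∃ w : X.Hwin a b k,
        X.Hmap (le_refl a) hbb' k w = x ∧ X.Hmap haa' (le_refl b) k w = y) := by
  refine ⟨fun w => ?_, fun x y hxy => ?_⟩
  · obtain ⟨u, hu, hdu, rfl⟩ := X.exists_homologyClass_eq w
    simp only [Hmap_homologyClass]
  · obtain ⟨u, hu, hdu, rfl⟩ := X.exists_homologyClass_eq x
    obtain ⟨v, hv, hdv, rfl⟩ := X.exists_homologyClass_eq y
    rw [Hmap_homologyClass, Hmap_homologyClass, homologyClass_eq_iff] at hxy
    obtain ⟨z, hz, he⟩ := hxy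
    have hw : u - X.d (k + 1) z ∈ X.lvl b (k + 1) := by
      have h := sub_mem hv (X.lvl_mono ha'b _ he)
      rwa [show v - (X.d (k + 1) z - (u - v)) = u - X.d (k + 1) z by abel] at h
    have hdw : X.d k (u - X.d (k + 1) z) ∈ X.lvl a k := by
      rwa [map_sub, X.dd, sub_zero]
    refine ⟨X.homologyClass _ hw hdw, ?_, ?_⟩
    · rw [Hmap_homologyClass, homologyClass_eq_iff]
      refine ⟨-z, neg_mem hz, ?_⟩
      rw [map_neg, show -X.d (k + 1) z - (u - X.d (k + 1) z - u) = 0 by abel]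
      exact zero_mem _
    · rw [Hmap_homologyClass, homologyClass_eq_iff]
      refine ⟨0, zero_mem _, ?_⟩
      rwa [map_zero,
        show 0 - (u - X.d (k + 1) z - v) = X.d (k + 1) z - (u - v) by abel]
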